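/- For every n ≥ 1, every l ∈ ℝⁿ, every j ∈ Fin n, and every i ∈ Fin n with i ≠ j, the partial derivative with respect to the i-th coordinate of l ↦ log(softmax(l)_j) at l equals −softmax(l)_i, which is strictly negative. In particular, in naive invalid action masking — where the policy is updated using the unmasked log-probability log(softmax(l)_j) — the gradient on the logit of an invalid action i ∉ V with i ≠ j is nonzero, unlike under invalid action masking where it is zero. -/

import Mathlib

noncomputable def softmax {n : ℕ} (l : Fin n → ℝ) (i : Fin n) : ℝ :=
  Real.exp (l i) / ∑ j, Real.exp (l j)

theorem sum_exp_pos {n : ℕ} (i : Fin n) (l : Fin n → ℝ) : 0 < ∑ k, Real.exp (l k) :=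
  Finset.sum_pos (fun k _ => Real.exp_pos (l k)) ⟨i, Finset.mem_univ i⟩

theorem softmax_pos {n : ℕ} (l : Fin n → ℝ) (i : Fin n) : 0 < softmax l i :=
  div_pos (Real.exp_pos _) (sum_exp_pos i l)

theorem log_softmax {n : ℕ} (l : Fin n → ℝ) (j : Fin n) :
    Real.log (softmax l j) = l j - Real.log (∑ k, Real.exp (l k)) := by
  rw [softmax, Real.log_div (Real.exp_ne_zero _) (sum_exp_pos j l).ne', Real.log_exp]

theorem hasDerivAt_sum_exp_update {n : ℕ} (l : Fin n → ℝ) (i : Fin n) (t : ℝ) :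
    HasDerivAt (fun s : ℝ => ∑ k, Real.exp (Function.update l i s k)) (Real.exp t) t := by
  have sum_eq : ∀ s : ℝ, ∑ k, Real.exp (Function.update l i s k) =
      Real.exp s + ∑ k ∈ Finset.univ.erase i, Real.exp (l k) := by
    intro s
    rw [← Finset.add_sum_erase _ _ (Finset.mem_univ i), Function.update_self]
    congr 1
    refine Finset.sum_congr rfl fun k hk => ?_
    rw [Function.update_of_ne (Finset.ne_of_mem_erase hk)]
  simp only [sum_eq]
  exact (Real.hasDerivAt_exp t).add_const _

theorem naive_masking_offdiag_gradient_neg (n : ℕ) (hn : 1 ≤ n) (l : Fin n → ℝ)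
    (j : Fin n) (i : Fin n) (hij : i ≠ j) :
    HasDerivAt (fun t : ℝ => Real.log (softmax (Function.update l i t) j))
      (-(softmax l i)) (l i) ∧ -(softmax l i) < 0 := by
  refine ⟨?_, neg_lt_zero.mpr (softmax_pos l i)⟩
  simp only [log_softmax, Function.update_of_ne hij.symm]
  have h := ((hasDerivAt_sum_exp_update l i (l i)).log (sum_exp_pos i _).ne').const_sub (l j)
  rwa [Function.update_eq_self] at h
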